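/- Minimal Γ_d-unitary extension of a Γ_d-isometry and lifting of commutants: Let (S_1,…,S_{d−1},V) be a Γ_d-isometry on a complex Hilbert space H. Then there exist a Hilbert space K containing H as a closed subspace and a Γ_d-unitary (R_1,…,R_{d−1},U) on K extending (S_1,…,S_{d−1},V) (i.e. H is invariant for each R_i and for U, with R_i|_H = S_i for each i and U|_H = V) which is minimal in the sense that K equals the closed linear span of {U^m h : h ∈ H, m ∈ ℤ}. Moreover, this extension can be chosen so that a bounded operator X on H commutes with each of S_1,…,S_{d−1},V if and only if X has a unique extension Y on K with ‖Y‖ = ‖X‖ commuting with each of R_1,…,R_{d−1},U. -/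

import Mathlib

open ContinuousLinearMap

noncomputable section

namespace GammaOps

/-- The `i`-th elementary symmetric polynomial of an `n`-tuple of complex numbers. -/
def esymC (n i : ℕ) (w : Fin n → ℂ) : ℂ :=
  ∑ S ∈ Finset.univ.powersetCard i, ∏ k ∈ S, w k

universe u v

variable {H : Type u} [NormedAddCommGroup H] [InnerProductSpace ℂ H] [CompleteSpace H]

/-- Evaluation of a polynomial in `n` variables on an `n`-tuple of (commuting) bounded
operators. -/
def opEval {n : ℕ} (q : MvPolynomial (Fin n) ℂ) (T : Fin n → H →L[ℂ] H) : H →L[ℂ] H :=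
  ∑ m ∈ q.support, MvPolynomial.coeff m q • (List.ofFn fun i => (T i) ^ (m i)).prod

/-- A commuting tuple `(T_1, …, T_n)` is a `Γ_n`-contraction if `Γ_n` is a spectral
set: `‖q(T)‖ ≤ sup { |q(s_1(w), …, s_n(w))| : w ∈ closed unit polydisk of ℂ^n }` for
every polynomial `q`. -/
def IsGammaContraction (n : ℕ) (T : Fin n → H →L[ℂ] H) : Prop :=
  (∀ i j, Commute (T i) (T j)) ∧
  ∀ q : MvPolynomial (Fin n) ℂ,
    ‖opEval q T‖ ≤
      ⨆ w : {w : Fin n → ℂ // ∀ k, ‖w k‖ ≤ 1},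
        ‖MvPolynomial.eval (fun i : Fin n => esymC n ((i : ℕ) + 1) w.1) q‖

/-- A `Γ_d`-isometry: a commuting tuple `(S_1, …, S_{d-1}, V)` such that `V` is an
isometry, `S_{d-i} = S_i^* V` for each `i`, and
`(((d-1)/d) S_1, …, (1/d) S_{d-1})` is a `Γ_{d-1}`-contraction.  Here `S i` denotes
`S_{i+1}`, so that `S i.rev` denotes `S_{d-(i+1)}`. -/
def IsGammaIsometry (d : ℕ) (S : Fin (d - 1) → H →L[ℂ] H) (V : H →L[ℂ] H) : Prop :=
  (∀ i j, Commute (S i) (S j)) ∧ (∀ i, Commute (S i) V) ∧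
  (∀ x, ‖V x‖ = ‖x‖) ∧
  (∀ i, S i.rev = adjoint (S i) * V) ∧
  IsGammaContraction (d - 1) (fun i => (((d - 1 - (i : ℕ) : ℕ) : ℂ) / (d : ℂ)) • S i)

variable {K : Type v} [NormedAddCommGroup K] [InnerProductSpace ℂ K] [CompleteSpace K]

/-- A `Γ_d`-unitary: a tuple `(R_1, …, R_{d-1}, U)` such that there are commuting
unitaries `U_1, …, U_d` with `R_i = s_i(U_1, …, U_d)` and `U = U_1 ⋯ U_d`.  Here `R i`
denotes `R_{i+1}`. -/
def IsGammaUnitary (d : ℕ) (R : Fin (d - 1) → K →L[ℂ] K) (U : K →L[ℂ] K) : Prop :=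
  ∃ Un : Fin d → K →L[ℂ] K,
    (∀ k, adjoint (Un k) * Un k = 1 ∧ Un k * adjoint (Un k) = 1) ∧
    (∀ k l, Commute (Un k) (Un l)) ∧
    (∀ i : Fin (d - 1),
      R i = ∑ S ∈ Finset.univ.powersetCard ((i : ℕ) + 1), ((S.sort (· ≤ ·)).map Un).prod) ∧
    U = (List.ofFn Un).prod

/-- Integer powers of a unitary `U`: `U^m` for `m ≥ 0` and `(U^*)^{-m}` for `m < 0`. -/
def zpowU (U : K →L[ℂ] K) (m : ℤ) : K →L[ℂ] K :=
  if 0 ≤ m then U ^ m.toNat else (adjoint U) ^ (-m).toNat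



/-! ### Elementary symmetric functions and roots of polynomials -/

lemma esymC_zero (n : ℕ) (w : Fin n → ℂ) : esymC n 0 w = 1 := by
  simp [esymC]

lemma prod_sub_algebraMap_mul {A : Type*} [CommRing A] [Algebra ℂ A] (n : ℕ) (w : Fin n → ℂ)
    (a t : A) :
    ∏ j, (a - algebraMap ℂ A (w j) * t) =
      ∑ i ∈ Finset.range (n + 1), (-1) ^ i * algebraMap ℂ A (esymC n i w) * t ^ i * a ^ (n - i) := by
  have h : ∀ j, a - algebraMap ℂ A (w j) * t = -(algebraMap ℂ A (w j) * t) + a := fun j => by ring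
  simp_rw [h]
  rw [Finset.prod_add, Finset.sum_powerset]
  simp only [Finset.card_univ, Fintype.card_fin]
  refine Finset.sum_congr rfl fun i _ => ?_
  rw [esymC, map_sum, Finset.mul_sum, Finset.sum_mul, Finset.sum_mul]
  refine Finset.sum_congr rfl fun s hs => ?_
  have hc := (Finset.mem_powersetCard.1 hs).2
  rw [Finset.prod_neg, Finset.prod_mul_distrib, Finset.prod_const, Finset.prod_const,
    Finset.card_sdiff_of_subset (Finset.subset_univ _), hc, map_prod]
  simp [mul_assoc]

/-- Every monic polynomial splits: the elementary symmetric functions may be prescribed. -/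
lemma exists_esymC_eq (n : ℕ) (c : ℕ → ℂ) (hc : c 0 = 1) :
    ∃ w : Fin n → ℂ, ∀ i ≤ n, esymC n i w = c i := by
  classical
  let P : Polynomial ℂ :=
    ∑ i ∈ Finset.range (n + 1), Polynomial.C ((-1) ^ i * c i) * Polynomial.X ^ (n - i)
  have hcoeff : ∀ i ≤ n, P.coeff (n - i) = (-1) ^ i * c i := by
    intro i hi
    simp only [P, Polynomial.finsetSum_coeff, Polynomial.coeff_C_mul_X_pow]
    rw [Finset.sum_eq_single i]
    · simp
    · intro b hb hbi
      rw [Finset.mem_range] at hb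
      rw [if_neg (by omega)]
    · intro h
      simp at h
      omega
  have hdeg : P.natDegree ≤ n := by
    refine Polynomial.natDegree_sum_le_of_forall_le _ _ fun i _ => ?_
    exact (Polynomial.natDegree_C_mul_X_pow_le _ _).trans (Nat.sub_le _ _)
  have hlead : P.coeff n = 1 := by simpa [hc] using hcoeff 0 (Nat.zero_le n)
  have hmonic : P.Monic := Polynomial.monic_of_natDegree_le_of_coeff_eq_one n hdeg hlead
  have hnat : P.natDegree = n :=
    le_antisymm hdeg (Polynomial.le_natDegree_of_ne_zero (by rw [hlead]; exact one_ne_zero))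
  have hsplit : P.Splits := IsAlgClosed.splits P
  have hcard : P.roots.toList.length = n := by
    rw [Multiset.length_toList, ← hsplit.natDegree_eq_card_roots, hnat]
  have hP : P = (P.roots.map fun a => Polynomial.X - Polynomial.C a).prod :=
    hsplit.eq_prod_roots_of_monic hmonic
  refine ⟨fun j => P.roots.toList.get (j.cast hcard.symm), fun i hi => ?_⟩
  set w : Fin n → ℂ := fun j => P.roots.toList.get (j.cast hcard.symm) with hw
  have hP2 : P = ∏ j, (Polynomial.X - Polynomial.C (w j)) := by
    have h1 : P.roots = Multiset.map w Finset.univ.val := by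
      have : List.ofFn w = P.roots.toList := by
        refine List.ext_get (by simp [hcard]) fun k h₁ h₂ => ?_
        simp [hw]
      rw [← Multiset.coe_toList P.roots, ← this]
      simp [List.ofFn_eq_map, Fin.univ_val_map]
    conv_lhs => rw [hP, h1, Multiset.map_map]
    rfl
  have h3 := prod_sub_algebraMap_mul n w (Polynomial.X : Polynomial ℂ) 1
  simp only [mul_one, one_pow, Polynomial.algebraMap_eq] at h3
  rw [← hP2] at h3
  have h4 := hcoeff i hi
  rw [h3, Polynomial.finsetSum_coeff, Finset.sum_eq_single i] at h4
  · have h5 : ((-1 : Polynomial ℂ) ^ i * Polynomial.C (esymC n i w) * Polynomial.X ^ (n - i))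
        = Polynomial.C ((-1) ^ i * esymC n i w) * Polynomial.X ^ (n - i) := by simp
    rw [h5, Polynomial.coeff_C_mul_X_pow, if_pos rfl] at h4
    exact mul_left_cancel₀ (pow_ne_zero _ (by norm_num)) h4
  · intro b hb hbi
    have h5 : ((-1 : Polynomial ℂ) ^ b * Polynomial.C (esymC n b w) * Polynomial.X ^ (n - b))
        = Polynomial.C ((-1) ^ b * esymC n b w) * Polynomial.X ^ (n - b) := by simp
    rw [Finset.mem_range] at hb
    rw [h5, Polynomial.coeff_C_mul_X_pow, if_neg (by omega)]
  · intro h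
    simp at h
    omega

/-- Polynomial growth of the coefficients of a power series. -/
def HasCoeffBound (C : ℝ) (k : ℕ) (f : PowerSeries ℂ) : Prop :=
  ∀ n, ‖PowerSeries.coeff n f‖ ≤ C * ((n : ℝ) + 1) ^ k

lemma HasCoeffBound.mul {C C' : ℝ} {k k' : ℕ} {f g : PowerSeries ℂ} (hC : 0 ≤ C) (hC' : 0 ≤ C')
    (hf : HasCoeffBound C k f) (hg : HasCoeffBound C' k' g) :
    HasCoeffBound (C * C') (k + k' + 1) (f * g) := by
  intro n
  rw [PowerSeries.coeff_mul]
  refine (norm_sum_le _ _).trans ?_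
  have : ∀ p ∈ Finset.HasAntidiagonal.antidiagonal n, ‖PowerSeries.coeff p.1 f * PowerSeries.coeff p.2 g‖ ≤
      (C * ((n : ℝ) + 1) ^ k) * (C' * ((n : ℝ) + 1) ^ k') := by
    intro p hp
    have hp' := Finset.HasAntidiagonal.mem_antidiagonal.1 hp
    have h1 : (p.1 : ℝ) ≤ n := by exact_mod_cast (by omega : p.1 ≤ n)
    have h2 : (p.2 : ℝ) ≤ n := by exact_mod_cast (by omega : p.2 ≤ n)
    rw [norm_mul]
    refine mul_le_mul ((hf p.1).trans ?_) ((hg p.2).trans ?_) (norm_nonneg _) (by positivity)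
    · gcongr
    · gcongr
  refine (Finset.sum_le_sum this).trans (le_of_eq ?_)
  rw [Finset.sum_const, Finset.Nat.card_antidiagonal, nsmul_eq_mul]
  push_cast
  ring

lemma hasCoeffBound_one : HasCoeffBound 1 0 1 := by
  intro n
  rw [PowerSeries.coeff_one]
  split_ifs <;> simp

lemma mk_pow_mul_one_sub (a : ℂ) :
    PowerSeries.mk (fun n => a ^ n) * (1 - algebraMap ℂ (PowerSeries ℂ) a * PowerSeries.X) = 1 := by
  ext n
  rw [mul_sub, mul_one, map_sub, mul_comm (algebraMap ℂ (PowerSeries ℂ) a), ← mul_assoc]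
  cases n with
  | zero => simp
  | succ n =>
    rw [PowerSeries.algebraMap_apply, Algebra.algebraMap_self_apply, PowerSeries.coeff_mul_C,
      PowerSeries.coeff_succ_mul_X]
    simp [PowerSeries.coeff_one, pow_succ]

lemma hasCoeffBound_prod_mk {m : ℕ} (v : Fin m → ℂ) (hv : ∀ j, ‖v j‖ ≤ 1) (s : Finset (Fin m)) :
    HasCoeffBound 1 s.card (∏ j ∈ s, PowerSeries.mk (fun n => v j ^ n)) := by
  classical
  induction s using Finset.induction_on with
  | empty => simpa using hasCoeffBound_one
  | insert a s ha ih =>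
    rw [Finset.prod_insert ha, Finset.card_insert_of_notMem ha]
    have h : HasCoeffBound 1 0 (PowerSeries.mk (fun n => v a ^ n)) := by
      intro n
      rw [PowerSeries.coeff_mk, norm_pow]
      simpa using pow_le_one₀ (norm_nonneg _) (hv a)
    simpa using h.mul zero_le_one zero_le_one ih

lemma exists_hasCoeffBound_prod_one_sub {m : ℕ} (v : Fin m → ℂ) (s : Finset (Fin m)) :
    ∃ C k, 0 ≤ C ∧ HasCoeffBound C k
      (∏ j ∈ s, (1 - algebraMap ℂ (PowerSeries ℂ) (v j) * PowerSeries.X)) := by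
  classical
  induction s using Finset.induction_on with
  | empty => exact ⟨1, 0, zero_le_one, by simpa using hasCoeffBound_one⟩
  | insert a s ha ih =>
    obtain ⟨C, k, hC, h⟩ := ih
    rw [Finset.prod_insert ha]
    have h' : HasCoeffBound (1 + ‖v a‖) 0
        (1 - algebraMap ℂ (PowerSeries ℂ) (v a) * PowerSeries.X) := by
      intro n
      rw [map_sub, PowerSeries.algebraMap_apply, Algebra.algebraMap_self_apply,
        PowerSeries.coeff_C_mul, PowerSeries.coeff_one, PowerSeries.coeff_X]
      refine (norm_sub_le _ _).trans ?_
      rw [pow_zero, mul_one, norm_mul]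
      gcongr
      · split_ifs <;> simp
      · split_ifs <;> simp
    exact ⟨_, _, by positivity, h'.mul (by positivity) hC h⟩

/-- The symmetrized polydisk is polynomially convex. -/
lemma norm_le_one_of_forall_eval_le {m : ℕ} (w : Fin m → ℂ)
    (hw : ∀ q : MvPolynomial (Fin m) ℂ,
      ‖MvPolynomial.eval (fun i : Fin m => esymC m ((i : ℕ) + 1) w) q‖ ≤
      ⨆ v : {v : Fin m → ℂ // ∀ k, ‖v k‖ ≤ 1},
        ‖MvPolynomial.eval (fun i : Fin m => esymC m ((i : ℕ) + 1) v.1) q‖) (j : Fin m) :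
    ‖w j‖ ≤ 1 := by
  classical
  let E : PowerSeries (MvPolynomial (Fin m) ℂ) :=
    1 + ∑ i : Fin m, (-1) ^ ((i : ℕ) + 1) * PowerSeries.C (MvPolynomial.X i) *
      PowerSeries.X ^ ((i : ℕ) + 1)
  let G : PowerSeries (MvPolynomial (Fin m) ℂ) := PowerSeries.invOfUnit E 1
  have hEG : E * G = 1 := PowerSeries.mul_invOfUnit E 1 (by simp [E])
  have hE : ∀ v : Fin m → ℂ,
      PowerSeries.map (MvPolynomial.eval (fun i : Fin m => esymC m ((i : ℕ) + 1) v)) E =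
        ∏ j, (1 - algebraMap ℂ (PowerSeries ℂ) (v j) * PowerSeries.X) := by
    intro v
    rw [prod_sub_algebraMap_mul, Finset.sum_range_succ', add_comm]
    simp only [E, map_add, map_one, map_sum, map_mul, map_pow, map_neg, PowerSeries.map_C,
      PowerSeries.map_X, MvPolynomial.eval_X, one_pow, mul_one, esymC_zero, pow_zero]
    rw [← Fin.sum_univ_eq_sum_range (fun i => (-1) ^ (i + 1) *
      algebraMap ℂ (PowerSeries ℂ) (esymC m (i + 1) v) * PowerSeries.X ^ (i + 1)) m]
    rfl
  have hGE : ∀ v : Fin m → ℂ,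
      (∏ j, (1 - algebraMap ℂ (PowerSeries ℂ) (v j) * PowerSeries.X)) *
        PowerSeries.map (MvPolynomial.eval (fun i : Fin m => esymC m ((i : ℕ) + 1) v)) G = 1 := by
    intro v
    rw [← hE, ← map_mul, hEG, map_one]
  have hG : ∀ v : Fin m → ℂ,
      PowerSeries.map (MvPolynomial.eval (fun i : Fin m => esymC m ((i : ℕ) + 1) v)) G =
        ∏ j, PowerSeries.mk (fun n => v j ^ n) := by
    intro v
    refine (left_inv_eq_right_inv ?_ (hGE v)).symm
    rw [← Finset.prod_mul_distrib]
    simp only [mk_pow_mul_one_sub, Finset.prod_const_one]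
  have hbound : HasCoeffBound 1 m
      (PowerSeries.map (MvPolynomial.eval (fun i : Fin m => esymC m ((i : ℕ) + 1) w)) G) := by
    intro n
    rw [PowerSeries.coeff_map]
    refine (hw _).trans (Real.iSup_le (fun v => ?_) (by positivity))
    rw [← PowerSeries.coeff_map, hG]
    simpa using hasCoeffBound_prod_mk v.1 v.2 Finset.univ n
  obtain ⟨C, k, hC, hrest⟩ := exists_hasCoeffBound_prod_one_sub w (Finset.univ.erase j)
  have hmul := hrest.mul hC zero_le_one hbound
  have hkey : PowerSeries.mk (fun n => w j ^ n) =
      (∏ j ∈ Finset.univ.erase j, (1 - algebraMap ℂ (PowerSeries ℂ) (w j) * PowerSeries.X)) *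
      PowerSeries.map (MvPolynomial.eval (fun i : Fin m => esymC m ((i : ℕ) + 1) w)) G := by
    refine left_inv_eq_right_inv (mk_pow_mul_one_sub (w j)) ?_
    rw [← mul_assoc, Finset.mul_prod_erase Finset.univ
      (fun j => 1 - algebraMap ℂ (PowerSeries ℂ) (w j) * PowerSeries.X) (Finset.mem_univ j), hGE]
  rw [← hkey] at hmul
  by_contra! hlt
  have hpos : 0 < ‖w j‖ := by linarith
  have ht := (tendsto_pow_const_div_const_pow_of_one_lt (k + m + 1) hlt).comp
    (Filter.tendsto_add_atTop_nat 1)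
  have ht' := (ht.const_mul (C * ‖w j‖))
  rw [mul_zero] at ht'
  refine absurd (ge_of_tendsto' ht' fun n => ?_) (not_le.2 one_pos)
  have h1 := hmul n
  rw [PowerSeries.coeff_mk, norm_pow, mul_one] at h1
  simp only [Function.comp]
  push_cast
  rw [pow_succ ‖w j‖, mul_div_assoc', le_div_iff₀ (by positivity)]
  nlinarith

/-- Cohn's theorem: a self-inversive polynomial all of whose critical points lie in the closed
unit disk has all its roots on the unit circle. -/
lemma norm_eq_one_of_selfInversive (m : ℕ) (s : ℕ → ℂ) (hs0 : s 0 = 1)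
    (hs : ∀ i ≤ m + 1, s (m + 1 - i) = (starRingEnd ℂ) (s i) * s (m + 1))
    (w : Fin m → ℂ) (hw : ∀ j, ‖w j‖ ≤ 1)
    (hws : ∀ i ≤ m, esymC m i w = (((m + 1 - i : ℕ) : ℂ) / ((m + 1 : ℕ) : ℂ)) * s i)
    (a : Fin (m + 1) → ℂ) (ha : ∀ i ≤ m + 1, esymC (m + 1) i a = s i) (k : Fin (m + 1)) :
    ‖a k‖ = 1 := by
  have hm : ((m + 1 : ℕ) : ℂ) ≠ 0 := by exact_mod_cast Nat.succ_ne_zero m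
  have hu : ‖s (m + 1)‖ = 1 := by
    have h := congrArg norm (hs (m + 1) le_rfl)
    rw [Nat.sub_self, hs0, norm_mul, norm_one, RCLike.norm_conj] at h
    nlinarith [norm_nonneg (s (m + 1))]
  set p : ℂ → ℂ := fun z => ∑ i ∈ Finset.range (m + 2), (-1) ^ i * s i * z ^ (m + 1 - i) with hp
  have hpa : ∀ z, ∏ j, (z - a j) = p z := by
    intro z
    have h := prod_sub_algebraMap_mul (m + 1) a z 1
    simp only [Algebra.algebraMap_self_apply, mul_one, one_pow] at h
    rw [h]
    refine Finset.sum_congr rfl fun i hi => ?_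
    rw [ha i (by rw [Finset.mem_range] at hi; omega)]
  -- the derivative and its conjugate reciprocal
  have hD : ∀ z, ((m + 1 : ℕ) : ℂ) * ∏ j, (z - w j) =
      ∑ i ∈ Finset.range (m + 1), (-1) ^ i * ((m + 1 - i : ℕ) : ℂ) * s i * z ^ (m - i) := by
    intro z
    have h := prod_sub_algebraMap_mul m w z 1
    simp only [Algebra.algebraMap_self_apply, mul_one, one_pow] at h
    rw [h, Finset.mul_sum]
    refine Finset.sum_congr rfl fun i hi => ?_
    rw [hws i (by rw [Finset.mem_range] at hi; omega)]
    field_simp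
  have hN : ∀ z, ((m + 1 : ℕ) : ℂ) * ∏ j, (1 - (starRingEnd ℂ) (w j) * z) =
      ∑ i ∈ Finset.range (m + 1),
        (-1) ^ i * ((m + 1 - i : ℕ) : ℂ) * (starRingEnd ℂ) (s i) * z ^ i := by
    intro z
    have h := congrArg (starRingEnd ℂ) (prod_sub_algebraMap_mul m w 1 ((starRingEnd ℂ) z))
    simp only [Algebra.algebraMap_self_apply, mul_one, one_pow, map_prod, map_sub, map_one,
      map_mul, Complex.conj_conj, map_sum, map_pow, map_neg] at h
    rw [h, Finset.mul_sum]
    refine Finset.sum_congr rfl fun i hi => ?_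
    rw [hws i (by rw [Finset.mem_range] at hi; omega)]
    simp only [map_mul, map_div₀, map_natCast]
    field_simp
  have hid : ∀ z, ((m + 1 : ℕ) : ℂ) * p z - z * (((m + 1 : ℕ) : ℂ) * ∏ j, (z - w j)) =
      (-1) ^ (m + 1) * s (m + 1) *
        (((m + 1 : ℕ) : ℂ) * ∏ j, (1 - (starRingEnd ℂ) (w j) * z)) := by
    intro z
    rw [hD, hN, hp]
    have e1 : z * ∑ i ∈ Finset.range (m + 1), (-1) ^ i * ((m + 1 - i : ℕ) : ℂ) * s i * z ^ (m - i)
        = ∑ i ∈ Finset.range (m + 2),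
          (-1) ^ i * ((m + 1 - i : ℕ) : ℂ) * s i * z ^ (m + 1 - i) := by
      rw [Finset.sum_range_succ _ (m + 1), Nat.sub_self, Nat.cast_zero, mul_zero, zero_mul,
        zero_mul, add_zero, Finset.mul_sum]
      refine Finset.sum_congr rfl fun i hi => ?_
      rw [Finset.mem_range] at hi
      rw [show m + 1 - i = (m - i) + 1 by omega, pow_succ]
      ring
    have e2 : ∑ i ∈ Finset.range (m + 1),
        (-1) ^ i * ((m + 1 - i : ℕ) : ℂ) * (starRingEnd ℂ) (s i) * z ^ i
        = ∑ i ∈ Finset.range (m + 2),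
          (-1) ^ i * ((m + 1 - i : ℕ) : ℂ) * (starRingEnd ℂ) (s i) * z ^ i := by
      rw [Finset.sum_range_succ _ (m + 1), Nat.sub_self, Nat.cast_zero, mul_zero, zero_mul,
        zero_mul, add_zero]
    rw [e1, e2, Finset.mul_sum, ← Finset.sum_sub_distrib, ← Finset.sum_range_reflect,
      Finset.mul_sum]
    refine Finset.sum_congr rfl fun i hi => ?_
    have hi' : i ≤ m + 1 := by rw [Finset.mem_range] at hi; omega
    rw [show m + 2 - 1 - i = m + 1 - i by omega, show m + 1 - (m + 1 - i) = i by omega, hs i hi']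
    have h3 : (-1 : ℂ) ^ (m + 1) * (-1) ^ i = (-1) ^ (m + 1 - i) := by
      rw [← pow_add, show m + 1 + i = (m + 1 - i) + 2 * i by omega, pow_add, pow_mul]
      simp
    rw [← h3, Nat.cast_sub hi']
    ring
  have hout : ∀ z, p z = 0 → ‖z‖ ≤ 1 := by
    intro z hz
    by_contra! hlt
    have h := congrArg norm (hid z)
    rw [hz, mul_zero, zero_sub, norm_neg, norm_mul, norm_mul, norm_mul, norm_mul, norm_mul, hu,
      norm_pow, norm_neg, norm_one, one_pow, one_mul, one_mul] at h
    have hle : ‖∏ j, (1 - (starRingEnd ℂ) (w j) * z)‖ ≤ ‖∏ j, (z - w j)‖ := by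
      rw [norm_prod, norm_prod]
      refine Finset.prod_le_prod (fun _ _ => norm_nonneg _) fun j _ => ?_
      rw [← sq_le_sq₀ (norm_nonneg _) (norm_nonneg _), ← Complex.normSq_eq_norm_sq,
        ← Complex.normSq_eq_norm_sq]
      have h1 : 1 ≤ Complex.normSq z := by
        rw [Complex.normSq_eq_norm_sq]; nlinarith
      have h2 : Complex.normSq (w j) ≤ 1 := by
        rw [Complex.normSq_eq_norm_sq]; nlinarith [hw j, norm_nonneg (w j)]
      have h3 : 0 ≤ (Complex.normSq z - 1) * (1 - Complex.normSq (w j)) :=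
        mul_nonneg (by linarith) (by linarith)
      simp only [Complex.normSq_apply, Complex.sub_re, Complex.sub_im, Complex.mul_re,
        Complex.mul_im, Complex.conj_re, Complex.conj_im, Complex.one_re, Complex.one_im] at *
      nlinarith
    have hpos : 0 < ‖∏ j, (z - w j)‖ := by
      rw [norm_pos_iff, Finset.prod_ne_zero_iff]
      intro j _ h0
      rw [sub_eq_zero] at h0
      have := hw j
      rw [← h0] at this
      linarith
    have hmpos : 0 < ‖((m + 1 : ℕ) : ℂ)‖ := norm_pos_iff.2 hm
    have h4 := mul_pos hmpos hpos
    nlinarith [mul_le_mul_of_nonneg_left hle hmpos.le]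
  have hroot : p (a k) = 0 := by
    rw [← hpa]
    exact Finset.prod_eq_zero (Finset.mem_univ k) (sub_self _)
  refine le_antisymm (hout _ hroot) ?_
  -- the reflected point is a root as well
  have hne : a k ≠ 0 := by
    intro h0
    rw [h0] at hroot
    have : p 0 = (-1) ^ (m + 1) * s (m + 1) := by
      simp only [hp]
      rw [Finset.sum_range_succ, Finset.sum_eq_zero]
      · simp
      · intro i hi
        rw [Finset.mem_range] at hi
        rw [zero_pow (by omega), mul_zero]
    rw [this] at hroot
    have := congrArg norm hroot
    simp [hu] at this
  have hrefl : p ((starRingEnd ℂ) (a k))⁻¹ = 0 := by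
    have hz : (starRingEnd ℂ) (a k) ≠ 0 := by simpa using hne
    set z := (starRingEnd ℂ) (a k) with hzdef
    have h1 : (starRingEnd ℂ) (p (a k)) = 0 := by rw [hroot, map_zero]
    have h2 : z ^ (m + 1) * p z⁻¹ =
        (-1) ^ (m + 1) * s (m + 1) * (starRingEnd ℂ) (p (a k)) := by
      simp only [hp, map_sum, map_mul, map_pow, map_neg, map_one, ← hzdef]
      rw [← Finset.sum_range_reflect, Finset.mul_sum, Finset.mul_sum]
      refine Finset.sum_congr rfl fun i hi => ?_
      have hi' : i ≤ m + 1 := by rw [Finset.mem_range] at hi; omega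
      rw [show m + 2 - 1 - i = m + 1 - i by omega, show m + 1 - (m + 1 - i) = i by omega, hs i hi']
      have h3 : (-1 : ℂ) ^ (m + 1) * (-1) ^ i = (-1) ^ (m + 1 - i) := by
        rw [← pow_add, show m + 1 + i = (m + 1 - i) + 2 * i by omega, pow_add, pow_mul]
        simp
      have h4 : z ^ (m + 1) * z⁻¹ ^ i = z ^ (m + 1 - i) := by
        rw [inv_pow, pow_sub₀ _ hz hi']
      rw [← h3, ← h4]
      ring
    rw [h1, mul_zero] at h2
    exact (mul_eq_zero.1 h2).resolve_left (pow_ne_zero _ hz)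
  have h := hout _ hrefl
  rw [norm_inv, RCLike.norm_conj] at h
  exact (inv_le_one₀ (norm_pos_iff.2 hne)).1 h

/-! ### The minimal unitary extension of an isometry -/

lemma commute_adjoint_of_commute {U Y : K →L[ℂ] K} (hU : adjoint U * U = 1)
    (hU' : U * adjoint U = 1) (h : Commute Y U) : Commute Y (adjoint U) := by
  have h1 : adjoint U * (Y * U) * adjoint U = adjoint U * (U * Y) * adjoint U := by rw [h.eq]
  rw [mul_assoc, mul_assoc, hU', mul_one, ← mul_assoc, hU, one_mul] at h1
  exact h1.symm

/-- The bounded sequences `(x_n)` with `V^* x_{n+1} = x_n`, which stand for the sequences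
`n ↦ P_H U^n x` when `U` is the minimal unitary extension of the isometry `V`. -/
def coherentSequences (V : H →L[ℂ] H) : Submodule ℂ (BoundedContinuousFunction ℕ H) where
  carrier := {f | ∀ n, adjoint V (f (n + 1)) = f n}
  add_mem' hf hg n := by simp [hf n, hg n]
  zero_mem' n := by simp
  smul_mem' c f hf n := by simp [hf n]

namespace coherentSequences

variable {V : H →L[ℂ] H}

instance : CompleteSpace (coherentSequences V) := by
  refine IsClosed.completeSpace_coe (s := (coherentSequences V : Set (BoundedContinuousFunction ℕ H)))
    (hs := ?_)
  have : (coherentSequences V : Set (BoundedContinuousFunction ℕ H)) =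
      ⋂ n, {f | adjoint V (f (n + 1)) = f n} := by
    ext f
    simp only [Set.mem_iInter]
    rfl
  rw [this]
  exact isClosed_iInter fun n => isClosed_eq
    ((adjoint V).continuous.comp (continuous_eval_const (n + 1))) (continuous_eval_const n)

lemma norm_adjoint_apply_le (hV : ∀ x, ‖V x‖ = ‖x‖) (x : H) : ‖adjoint V x‖ ≤ ‖x‖ := by
  have h : ‖adjoint V‖ ≤ 1 := by
    rw [LinearIsometryEquiv.norm_map]
    exact V.opNorm_le_bound zero_le_one fun x => by simp [hV]
  simpa using (adjoint V).le_of_opNorm_le h x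

lemma adjoint_mul_self_eq_one (hV : ∀ x, ‖V x‖ = ‖x‖) : adjoint V * V = 1 :=
  V.norm_map_iff_adjoint_comp_self.1 hV

lemma tendsto_norm (hV : ∀ x, ‖V x‖ = ‖x‖) (f : coherentSequences V) :
    Filter.Tendsto (fun n => ‖f.1 n‖) Filter.atTop (nhds ‖f‖) := by
  have hmono : Monotone fun n => ‖f.1 n‖ := monotone_nat_of_le_succ fun n => by
    have := norm_adjoint_apply_le hV (f.1 (n + 1))
    rwa [f.2 n] at this
  have h := tendsto_atTop_ciSup hmono ⟨‖f‖, by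
    rintro _ ⟨n, rfl⟩
    exact f.1.norm_coe_le_norm n⟩
  rwa [← BoundedContinuousFunction.norm_eq_iSup_norm] at h

lemma parallelogram (hV : ∀ x, ‖V x‖ = ‖x‖) (f g : coherentSequences V) :
    ‖f + g‖ * ‖f + g‖ + ‖f - g‖ * ‖f - g‖ = 2 * (‖f‖ * ‖f‖ + ‖g‖ * ‖g‖) := by
  have h1 := ((tendsto_norm hV (f + g)).mul (tendsto_norm hV (f + g))).add
    ((tendsto_norm hV (f - g)).mul (tendsto_norm hV (f - g)))
  have h2 := (((tendsto_norm hV f).mul (tendsto_norm hV f)).add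
    ((tendsto_norm hV g).mul (tendsto_norm hV g))).const_mul 2
  refine tendsto_nhds_unique h1 (h2.congr fun n => ?_)
  rw [← sq, ← sq, ← sq, ← sq]
  exact (parallelogram_law_with_norm ℂ (f.1 n) (g.1 n)).symm

/-- The Hilbert space structure on the space of coherent sequences. -/
@[reducible]
def innerProductSpace (hV : ∀ x, ‖V x‖ = ‖x‖) : InnerProductSpace ℂ (coherentSequences V) :=
  InnerProductSpace.ofNorm ℂ (parallelogram hV)

/-- The bilateral shift on coherent sequences. -/
def shift (hV : ∀ x, ‖V x‖ = ‖x‖) : coherentSequences V ≃ₗᵢ[ℂ] coherentSequences V where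
  toFun f := ⟨f.1.compContinuous ⟨fun n => n + 1, by fun_prop⟩, fun n => f.2 (n + 1)⟩
  map_add' f g := rfl
  map_smul' c f := rfl
  invFun f := ⟨BoundedContinuousFunction.ofNormedAddCommGroupDiscrete
    (fun n => adjoint V (f.1 n)) ‖f‖
    (fun n => (norm_adjoint_apply_le hV _).trans (f.1.norm_coe_le_norm n)), fun n => by
      simp [f.2 n]⟩
  left_inv f := by
    ext n
    exact f.2 n
  right_inv f := by
    ext n
    exact f.2 n
  norm_map' f := tendsto_nhds_unique (tendsto_norm hV _)
    ((tendsto_norm hV f).comp (Filter.tendsto_add_atTop_nat 1))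

lemma norm_pow_apply (hV : ∀ x, ‖V x‖ = ‖x‖) (n : ℕ) (x : H) : ‖(V ^ n) x‖ = ‖x‖ := by
  induction n with
  | zero => simp
  | succ n ih => rw [pow_succ', mul_apply_eq_comp, hV, ih]

/-- The embedding `h ↦ (V^n h)` into the coherent sequences. -/
def embed (hV : ∀ x, ‖V x‖ = ‖x‖) : H →ₗᵢ[ℂ] coherentSequences V where
  toFun x := ⟨BoundedContinuousFunction.ofNormedAddCommGroupDiscrete
    (fun n => (V ^ n) x) ‖x‖ (fun n => (norm_pow_apply hV n x).le), fun n => by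
      have := congrArg (fun T : H →L[ℂ] H => T ((V ^ n) x)) (adjoint_mul_self_eq_one hV)
      change adjoint V ((V ^ (n + 1)) x) = (V ^ n) x
      rw [pow_succ']
      exact this⟩
  map_add' x y := by
    ext n
    simp
  map_smul' c x := by
    ext n
    simp
  norm_map' x := tendsto_nhds_unique (tendsto_norm hV _)
    (tendsto_const_nhds.congr fun n => (norm_pow_apply hV n x).symm)

/-- Coordinatewise action of an operator commuting with `V^*`. -/
def mapOp (Z : H →L[ℂ] H) (hZ : Commute Z (adjoint V)) :
    coherentSequences V →L[ℂ] coherentSequences V :=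
  ((ContinuousLinearMap.compLeftContinuousBounded ℕ Z).comp
    (coherentSequences V).subtypeL).codRestrict _ fun f n => by
      have h : Z (adjoint V (f.1 (n + 1))) = adjoint V (Z (f.1 (n + 1))) :=
        congrArg (fun T : H →L[ℂ] H => T (f.1 (n + 1))) hZ.eq
      rw [f.2 n] at h
      simpa using h.symm

lemma tendsto_inner (hV : ∀ x, ‖V x‖ = ‖x‖) (g f : coherentSequences V) :
    letI := innerProductSpace hV
    Filter.Tendsto (fun n => inner ℂ (g.1 n) (f.1 n)) Filter.atTop (nhds (inner ℂ g f)) := by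
  let _ := innerProductSpace hV
  have hn : ∀ g : coherentSequences V, Filter.Tendsto
      (fun n => (RCLike.ofReal ‖g.1 n‖ : ℂ) ^ 2) Filter.atTop (nhds ((RCLike.ofReal ‖g‖ : ℂ) ^ 2)) :=
    fun g => ((RCLike.continuous_ofReal.tendsto _).comp (tendsto_norm hV g)).pow 2
  have hpol := inner_eq_sum_norm_sq_div_four (𝕜 := ℂ) g f
  rw [hpol]
  have hn' : ∀ n, inner ℂ (g.1 n) (f.1 n) =
      ((RCLike.ofReal ‖(g + f).1 n‖ : ℂ) ^ 2 - (RCLike.ofReal ‖(g - f).1 n‖ : ℂ) ^ 2 +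
        ((RCLike.ofReal ‖(g - (RCLike.I : ℂ) • f).1 n‖ : ℂ) ^ 2 -
          (RCLike.ofReal ‖(g + (RCLike.I : ℂ) • f).1 n‖ : ℂ) ^ 2) * RCLike.I) / 4 :=
    fun n => inner_eq_sum_norm_sq_div_four (𝕜 := ℂ) (g.1 n) (f.1 n)
  simp_rw [hn']
  exact (((hn (g + f)).sub (hn (g - f))).add
    (((hn (g - (RCLike.I : ℂ) • f)).sub (hn (g + (RCLike.I : ℂ) • f))).mul_const
      RCLike.I)).div_const 4

lemma inner_embed (hV : ∀ x, ‖V x‖ = ‖x‖) (x : H) (f : coherentSequences V) :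
    letI := innerProductSpace hV
    inner ℂ (embed hV x) f = inner ℂ x (f.1 0) := by
  refine tendsto_nhds_unique (tendsto_inner hV _ _) (tendsto_const_nhds.congr fun n => ?_)
  change _ = inner ℂ ((V ^ n) x) (f.1 n)
  induction n with
  | zero => simp
  | succ n ih =>
    rw [ih, pow_succ', mul_apply_eq_comp, ← adjoint_inner_right V, f.2 n]

end coherentSequences

/-- Every isometry has a minimal unitary extension to which its commutant lifts. -/
lemma exists_minimal_unitary_extension {H : Type u} [NormedAddCommGroup H]
    [InnerProductSpace ℂ H] [CompleteSpace H] (V : H →L[ℂ] H) (hV : ∀ x, ‖V x‖ = ‖x‖) :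
    ∃ (K : Type u) (_ : NormedAddCommGroup K) (_ : InnerProductSpace ℂ K)
      (_ : CompleteSpace K) (ι : H →ₗᵢ[ℂ] K) (U : K →L[ℂ] K),
      adjoint U * U = 1 ∧ U * adjoint U = 1 ∧ (∀ x, U (ι x) = ι (V x)) ∧
      (∀ y, (∀ (n : ℕ) (h : H), inner ℂ (ι h) ((U ^ n) y) = 0) → y = 0) ∧
      ∀ X : H →L[ℂ] H, Commute X V → ∃ Y : K →L[ℂ] K, Commute Y U ∧ ∀ x, Y (ι x) = ι (X x) := by
  let _ := coherentSequences.innerProductSpace hV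
  let e := coherentSequences.shift hV
  let U : coherentSequences V →L[ℂ] coherentSequences V := e.toContinuousLinearEquiv
  have hadj : adjoint U = (e.symm.toContinuousLinearEquiv : _ →L[ℂ] _) := by
    simp only [U]
    exact e.adjoint_eq_symm
  have hU : adjoint U * U = 1 := by
    rw [hadj]
    ext1 f
    exact e.symm_apply_apply f
  have hU' : U * adjoint U = 1 := by
    rw [hadj]
    ext1 f
    exact e.apply_symm_apply f
  have hpow : ∀ (n : ℕ) (f : coherentSequences V), ((U ^ n) f).1 0 = f.1 n := by
    intro n
    induction n with
    | zero => simp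
    | succ n ih =>
      intro f
      rw [pow_succ, mul_apply_eq_comp, ih]
      rfl
  refine ⟨coherentSequences V, inferInstance, inferInstance, inferInstance,
    coherentSequences.embed hV, U, hU, hU', fun x => ?_, fun f hf => ?_, fun X hX => ?_⟩
  · ext n
    change (V ^ (n + 1)) x = (V ^ n) (V x)
    rw [pow_succ]
    rfl
  · ext n
    refine ext_inner_left ℂ fun h => ?_
    have := hf n h
    rw [coherentSequences.inner_embed, hpow] at this
    simpa using this
  · have hX' : Commute (adjoint X) (adjoint V) := hX.star_star
    refine ⟨adjoint (coherentSequences.mapOp (adjoint X) hX'), ?_, fun x => ?_⟩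
    · have h1 : Commute (coherentSequences.mapOp (adjoint X) hX') U := rfl
      have h2 := (commute_adjoint_of_commute hU hU' h1).star_star
      simpa only [star_eq_adjoint, adjoint_adjoint] using h2
    · refine ext_inner_right ℂ fun f => ?_
      rw [adjoint_inner_left, coherentSequences.inner_embed, coherentSequences.inner_embed]
      exact adjoint_inner_right X _ _

section MinimalExtension

variable {ι : H →ₗᵢ[ℂ] K} {V : H →L[ℂ] H} {U : K →L[ℂ] K}

lemma pow_apply_embedding (hι : ∀ x, U (ι x) = ι (V x)) (n : ℕ) (x : H) :
    (U ^ n) (ι x) = ι ((V ^ n) x) := by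
  induction n with
  | zero => simp
  | succ n ih => simp only [pow_succ', mul_apply_eq_comp, ih, hι]

lemma pow_adjoint_mul_pow (hU : adjoint U * U = 1) (n : ℕ) : adjoint U ^ n * U ^ n = 1 := by
  induction n with
  | zero => simp
  | succ n ih => rw [pow_succ, pow_succ', mul_assoc, ← mul_assoc (adjoint U) U, hU, one_mul, ih]

lemma norm_pow_adjoint_apply (hU' : U * adjoint U = 1) (n : ℕ) (y : K) :
    ‖(adjoint U ^ n) y‖ = ‖y‖ := by
  have h : ∀ x, ‖adjoint U x‖ = ‖x‖ := by
    rw [ContinuousLinearMap.norm_map_iff_adjoint_comp_self, adjoint_adjoint]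
    exact hU'
  exact coherentSequences.norm_pow_apply h n y

lemma dense_range_pow_adjoint (hU : adjoint U * U = 1) (hι : ∀ x, U (ι x) = ι (V x))
    (hmin : ∀ y, (∀ (n : ℕ) (h : H), inner ℂ (ι h) ((U ^ n) y) = 0) → y = 0) :
    Dense {y : K | ∃ (n : ℕ) (h : H), y = (adjoint U ^ n) (ι h)} := by
  have key : ∀ (n k : ℕ) (h : H),
      (adjoint U ^ n) (ι h) = (adjoint U ^ (n + k)) (ι ((V ^ k) h)) := by
    intro n k h
    rw [← pow_apply_embedding hι, pow_add, mul_apply_eq_comp,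
      ← mul_apply_eq_comp (adjoint U ^ k), pow_adjoint_mul_pow hU]
    rfl
  let D : Submodule ℂ K :=
    { carrier := {y : K | ∃ (n : ℕ) (h : H), y = (adjoint U ^ n) (ι h)}
      add_mem' := by
        rintro _ _ ⟨n, h, rfl⟩ ⟨k, g, rfl⟩
        refine ⟨n + k, (V ^ k) h + (V ^ n) g, ?_⟩
        rw [key n k h, key k n g, add_comm k n, ← map_add, ← map_add]
      zero_mem' := ⟨0, 0, by simp⟩
      smul_mem' := by
        rintro c _ ⟨n, h, rfl⟩
        exact ⟨n, c • h, by simp⟩ }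
  have hD : D.topologicalClosure = ⊤ := by
    rw [Submodule.topologicalClosure_eq_top_iff, Submodule.eq_bot_iff]
    intro y hy
    refine hmin y fun n h => ?_
    have := (Submodule.mem_orthogonal D y).1 hy _ ⟨n, h, rfl⟩
    rw [← adjoint_inner_left]
    convert this using 3
    exact star_pow U n
  exact (Submodule.dense_iff_topologicalClosure_eq_top (s := D)).2 hD

lemma eq_of_commute_of_eq_on (hU : adjoint U * U = 1) (hU' : U * adjoint U = 1)
    (hD : Dense {y : K | ∃ (n : ℕ) (h : H), y = (adjoint U ^ n) (ι h)})
    {Y Z : K →L[ℂ] K} (hY : Commute Y U) (hZ : Commute Z U)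
    (h : ∀ x, Y (ι x) = Z (ι x)) : Y = Z := by
  refine ContinuousLinearMap.coeFn_injective
    (Continuous.ext_on hD Y.continuous Z.continuous ?_)
  rintro _ ⟨n, x, rfl⟩
  have hY' := (commute_adjoint_of_commute hU hU' hY).pow_right n
  have hZ' := (commute_adjoint_of_commute hU hU' hZ).pow_right n
  rw [← mul_apply_eq_comp, ← mul_apply_eq_comp, hY'.eq, hZ'.eq,
    mul_apply_eq_comp, mul_apply_eq_comp, h]

lemma norm_eq_of_commute_of_extends (hU : adjoint U * U = 1) (hU' : U * adjoint U = 1)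
    (hD : Dense {y : K | ∃ (n : ℕ) (h : H), y = (adjoint U ^ n) (ι h)})
    {Y : K →L[ℂ] K} {X : H →L[ℂ] H} (hY : Commute Y U)
    (h : ∀ x, Y (ι x) = ι (X x)) : ‖Y‖ = ‖X‖ := by
  refine le_antisymm (Y.opNorm_le_bound (norm_nonneg _) fun y => ?_)
    (X.opNorm_le_bound (norm_nonneg _) fun x => ?_)
  · refine hD.induction (P := fun y => ‖Y y‖ ≤ ‖X‖ * ‖y‖) ?_
      (isClosed_le (by fun_prop) (by fun_prop)) y
    rintro _ ⟨n, x, rfl⟩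
    have hY' := (commute_adjoint_of_commute hU hU' hY).pow_right n
    rw [← mul_apply_eq_comp, hY'.eq, mul_apply_eq_comp, h,
      norm_pow_adjoint_apply hU', norm_pow_adjoint_apply hU', ι.norm_map, ι.norm_map]
    exact X.le_opNorm x
  · rw [← ι.norm_map, ← h, ← ι.norm_map x]
    exact Y.le_opNorm _

end MinimalExtension

/-! ### Commutative von Neumann algebras -/

open WeakDual in
/-- The character space of a commutative von Neumann algebra is extremally disconnected. -/
lemma extremallyDisconnected_characterSpace {A : Type*} [CommCStarAlgebra A]
    (π : A →⋆ₐ[ℂ] (K →L[ℂ] K)) (hπ : Function.Injective π)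
    (hbi : Set.centralizer (Set.centralizer (Set.range π)) ⊆ Set.range π) :
    ExtremallyDisconnected (characterSpace ℂ A) := by
  refine ⟨fun W hW => ?_⟩
  let G := gelfandStarTransform A
  -- the closed span of the ranges of the elements supported in `W`
  let N : Submodule ℂ K := (Submodule.span ℂ
    {y | ∃ (g : A) (x : K), (∀ φ ∉ W, G g φ = 0) ∧ y = π g x}).topologicalClosure
  have hNc : IsClosed (N : Set K) := Submodule.isClosed_topologicalClosure _
  have : CompleteSpace N := hNc.completeSpace_coe
  have hNmem : ∀ (g : A) (x : K), (∀ φ ∉ W, G g φ = 0) → π g x ∈ N := fun g x hg =>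
    Submodule.le_topologicalClosure _ (Submodule.subset_span ⟨g, x, hg, rfl⟩)
  have hNle : ∀ T : K →L[ℂ] K, ∀ L : Submodule ℂ K, IsClosed (L : Set K) →
      (∀ (g : A) (x : K), (∀ φ ∉ W, G g φ = 0) → T (π g x) ∈ L) → ∀ x ∈ N, T x ∈ L := by
    intro T L hL hT x hx
    have hle : N ≤ L.comap (T : K →ₗ[ℂ] K) := by
      refine Submodule.topologicalClosure_minimal _ (Submodule.span_le.2 ?_)
        (hL.preimage T.continuous)
      rintro _ ⟨g, x, hg, rfl⟩
      exact hT g x hg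
    exact hle hx
  have hinv : ∀ B ∈ Set.centralizer (Set.range π), ∀ x ∈ N, B x ∈ N := by
    intro B hB
    refine hNle B N hNc fun g x hg => ?_
    have h : π g * B = B * π g := hB (π g) ⟨g, rfl⟩
    have h' : B (π g x) = π g (B x) := (congrArg (fun T : K →L[ℂ] K => T x) h).symm
    rw [h']
    exact hNmem g _ hg
  have hstar : ∀ B ∈ Set.centralizer (Set.range π), adjoint B ∈ Set.centralizer (Set.range π) := by
    rintro B hB _ ⟨g, rfl⟩
    have h : π (star g) * B = B * π (star g) := hB _ ⟨star g, rfl⟩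
    have h' := congrArg star h
    rw [star_mul, star_mul, ← map_star, star_star] at h'
    exact h'.symm
  have hP : N.starProjection ∈ Set.centralizer (Set.centralizer (Set.range π)) := by
    intro B hB
    ext x
    change B (N.starProjection x) = N.starProjection (B x)
    refine (Submodule.eq_starProjection_of_mem_of_inner_eq_zero
      (hinv B hB _ (N.starProjection_apply_mem x)) fun y hy => ?_).symm
    rw [← map_sub, ← adjoint_inner_right]
    exact N.starProjection_inner_eq_zero x _ (hinv _ (hstar B hB) y hy)
  obtain ⟨p, hp⟩ := hbi hP
  have hcomplex : ∀ f : C(characterSpace ℂ A, ℝ), ∃ g : A, ∀ φ, G g φ = (f φ : ℂ) := by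
    intro f
    refine ⟨G.symm ⟨fun φ => (f φ : ℂ), by fun_prop⟩, fun φ => ?_⟩
    rw [StarAlgEquiv.apply_symm_apply]
    rfl
  have hone : ∀ φ ∈ W, G p φ = 1 := by
    intro φ hφ
    obtain ⟨f, hf0, hf1, -⟩ := exists_continuous_zero_one_of_isClosed hW.isClosed_compl
      (isClosed_singleton (x := φ)) (by simpa using hφ)
    obtain ⟨g, hg⟩ := hcomplex f
    have hg0 : ∀ ψ ∉ W, G g ψ = 0 := fun ψ hψ => by rw [hg, hf0 hψ]; simp
    have hpg : p * g = g := by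
      refine hπ ?_
      rw [map_mul, hp]
      ext x
      exact N.starProjection_eq_self_iff.2 (hNmem g x hg0)
    have h := congrArg (fun a => G a φ) hpg
    simp only [map_mul, ContinuousMap.mul_apply, hg, hf1 (Set.mem_singleton φ)] at h
    simpa using h
  have hone' : ∀ φ ∈ closure W, G p φ = 1 := by
    intro φ hφ
    have hcl : IsClosed {φ | G p φ = 1} := isClosed_eq (G p).continuous continuous_const
    exact closure_minimal (fun ψ hψ => hone ψ hψ) hcl hφ
  have hzero : ∀ φ ∉ closure W, G p φ = 0 := by
    intro φ hφ
    obtain ⟨f, hf0, hf1, -⟩ := exists_continuous_zero_one_of_isClosed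
      (isClosed_closure (s := W)) (isClosed_singleton (x := φ)) (by simpa using hφ)
    obtain ⟨h, hh⟩ := hcomplex f
    have hhp : h * p = 0 := by
      refine hπ ?_
      rw [map_mul, hp, map_zero]
      ext x
      refine (Submodule.mem_bot ℂ).1 (hNle (π h) ⊥ (by simp) (fun g y hg => ?_) _
        (N.starProjection_apply_mem x))
      have hhg : h * g = 0 := by
        refine G.injective (ContinuousMap.ext fun ψ => ?_)
        change G (h * g) ψ = G 0 ψ
        rw [map_mul, ContinuousMap.mul_apply, map_zero]
        by_cases hψ : ψ ∈ W
        · rw [hh, hf0 (subset_closure hψ)]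
          simp
        · rw [hg ψ hψ, mul_zero]
          rfl
      have := congrArg (fun a => π a y) hhg
      simpa using this
    have h' := congrArg (fun a => G a φ) hhp
    simp only [map_mul, map_zero, ContinuousMap.mul_apply, hh, hf1 (Set.mem_singleton φ)] at h'
    simpa using h'
  have heq : closure W = {φ | G p φ ≠ 0} := by
    ext φ
    by_cases hφ : φ ∈ closure W
    · simp [hφ, hone' φ hφ]
    · simp [hφ, hzero φ hφ]
  rw [heq]
  exact isOpen_ne_fun (G p).continuous continuous_const

/-- Continuous selection over an extremally disconnected compact space. -/
lemma exists_continuous_selection {Ω : Type*} [TopologicalSpace Ω] [CompactSpace Ω] [T2Space Ω]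
    [ExtremallyDisconnected Ω] {n : ℕ} (F : Set (Ω × (Fin n → ℂ))) (hF : IsClosed F)
    (h : ∀ x, ∃ a : Fin n → ℂ, (∀ k, ‖a k‖ = 1) ∧ (x, a) ∈ F) :
    ∃ f : Ω → Fin n → ℂ, Continuous f ∧ ∀ x, (∀ k, ‖f x k‖ = 1) ∧ (x, f x) ∈ F := by
  let Y : Set (Ω × (Fin n → ℂ)) :=
    (Set.univ ×ˢ Set.pi Set.univ fun _ => Metric.sphere (0 : ℂ) 1) ∩ F
  have hY : IsCompact Y :=
    (isCompact_univ.prod (isCompact_univ_pi fun _ => isCompact_sphere _ _)).inter_right hF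
  have : CompactSpace Y := isCompact_iff_compactSpace.1 hY
  obtain ⟨s, hs, hs'⟩ := CompactT2.ExtremallyDisconnected.projective (A := Ω) (f := id)
    (g := fun y : Y => y.1.1) continuous_id (by fun_prop) (fun x => by
      obtain ⟨a, ha, haF⟩ := h x
      exact ⟨⟨(x, a), ⟨⟨Set.mem_univ _, fun k _ => by simpa using ha k⟩, haF⟩⟩, rfl⟩)
  refine ⟨fun x => (s x).1.2, by fun_prop, fun x => ⟨fun k => ?_, ?_⟩⟩
  · simpa using (s x).2.1.2 k (Set.mem_univ k)
  · have hx : (s x).1.1 = x := congrFun hs' x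
    have := (s x).2.2
    rwa [← Prod.mk.eta (p := (s x).1), hx] at this

lemma coe_aeval_eq_opEval {A : Type*} [CommCStarAlgebra A] (π : A →⋆ₐ[ℂ] (K →L[ℂ] K)) {n : ℕ}
    (q : MvPolynomial (Fin n) ℂ) (T : Fin n → A) :
    π (MvPolynomial.aeval T q) = opEval q (fun i => π (T i)) := by
  rw [MvPolynomial.aeval_def, MvPolynomial.eval₂_eq', map_sum, opEval]
  refine Finset.sum_congr rfl fun m _ => ?_
  rw [← Algebra.smul_def, map_smul, ← List.prod_ofFn, map_list_prod, List.map_ofFn]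
  congr 3
  ext i
  simp

open WeakDual in
/-- A character of a commutative operator algebra maps an operator tuple satisfying the
defining relations of a `Γ_d`-unitary to the distinguished boundary of the symmetrized polydisk. -/
lemma exists_unimodular_of_character {A : Type*} [CommCStarAlgebra A] (m : ℕ) (r : Fin m → A)
    (u : A) (hu : star u * u = 1) (hrev : ∀ i, r i.rev = star (r i) * u)
    (hq : ∀ q : MvPolynomial (Fin m) ℂ,
      ‖MvPolynomial.aeval (fun i : Fin m =>
        (((m + 1 - 1 - (i : ℕ) : ℕ) : ℂ) / ((m + 1 : ℕ) : ℂ)) • r i) q‖ ≤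
      ⨆ w : {w : Fin m → ℂ // ∀ k, ‖w k‖ ≤ 1},
        ‖MvPolynomial.eval (fun i : Fin m => esymC m ((i : ℕ) + 1) w.1) q‖)
    (φ : characterSpace ℂ A) :
    ∃ a : Fin (m + 1) → ℂ, (∀ k, ‖a k‖ = 1) ∧
      (∀ i : Fin m, esymC (m + 1) ((i : ℕ) + 1) a = φ (r i)) ∧
      esymC (m + 1) (m + 1) a = φ u := by
  let s : ℕ → ℂ := fun i =>
    if i = 0 then 1 else if h : i - 1 < m then φ (r ⟨i - 1, h⟩) else φ u
  have hs0 : s 0 = 1 := rfl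
  have hsr : ∀ i : Fin m, s ((i : ℕ) + 1) = φ (r i) := fun i => by simp [s]
  have hsu : s (m + 1) = φ u := by simp [s]
  have hconj : ∀ i ≤ m + 1, s (m + 1 - i) = (starRingEnd ℂ) (s i) * s (m + 1) := by
    intro i hi
    rcases Nat.eq_zero_or_pos i with rfl | hpos
    · simp [hs0]
    · rcases Nat.lt_or_ge m i with hlt | hle
      · obtain rfl : i = m + 1 := by omega
        rw [Nat.sub_self, hs0, hsu, starRingEnd_apply, ← map_star, ← map_mul, hu, map_one]
      · have h1 := hsr ⟨i - 1, by omega⟩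
        have h2 := hsr (Fin.rev ⟨i - 1, by omega⟩)
        rw [hrev, map_mul, map_star] at h2
        simp only [Fin.val_rev] at h1 h2
        rw [show i - 1 + 1 = i by omega] at h1
        rw [show m - (i - 1 + 1) + 1 = m + 1 - i by omega] at h2
        rw [h2, ← h1, hsu, starRingEnd_apply]
  obtain ⟨w, hw⟩ := exists_esymC_eq m
    (fun i => (((m + 1 - i : ℕ) : ℂ) / ((m + 1 : ℕ) : ℂ)) * s i) (by
      simp only [hs0, Nat.sub_zero, mul_one]
      exact div_self (by exact_mod_cast Nat.succ_ne_zero m))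
  obtain ⟨a, ha⟩ := exists_esymC_eq (m + 1) s hs0
  have hφ : ∀ x : A, ‖φ x‖ ≤ ‖x‖ := fun x => NonUnitalStarAlgHom.norm_apply_le φ x
  have hw1 : ∀ j, ‖w j‖ ≤ 1 := by
    refine norm_le_one_of_forall_eval_le w fun q => le_trans ?_ (hq q)
    refine le_trans (le_of_eq ?_) (hφ _)
    congr 1
    have h := MvPolynomial.comp_aeval_apply (fun i : Fin m =>
        (((m + 1 - 1 - (i : ℕ) : ℕ) : ℂ) / ((m + 1 : ℕ) : ℂ)) • r i)
        (CharacterSpace.toAlgHom φ) q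
    refine Eq.trans ?_ h.symm
    change MvPolynomial.eval _ q = MvPolynomial.eval _ q
    congr 2
    ext i
    have hi := i.2
    rw [hw _ (by omega), hsr, map_smul, smul_eq_mul,
      show m + 1 - ((i : ℕ) + 1) = m + 1 - 1 - i by omega]
    rfl
  refine ⟨a, norm_eq_one_of_selfInversive m s hs0 hconj w hw1 hw a ha, fun i => ?_, ?_⟩
  · rw [ha _ (by have := i.2; omega), hsr]
  · rw [ha _ le_rfl, hsu]

lemma continuous_esymC (n i : ℕ) : Continuous (esymC n i) := by
  unfold esymC
  fun_prop

open WeakDual in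
/-- Sufficient conditions for a tuple to be a `Γ_d`-unitary. -/
lemma isGammaUnitary_of_relations (m : ℕ) (R : Fin m → K →L[ℂ] K) (U : K →L[ℂ] K)
    (hRR : ∀ i j, Commute (R i) (R j)) (hRU : ∀ i, Commute (R i) U) (hU : adjoint U * U = 1)
    (hU' : U * adjoint U = 1) (hrev : ∀ i, R i.rev = adjoint (R i) * U)
    (hq : ∀ q : MvPolynomial (Fin m) ℂ,
      ‖opEval q (fun i : Fin m =>
        (((m + 1 - 1 - (i : ℕ) : ℕ) : ℂ) / ((m + 1 : ℕ) : ℂ)) • R i)‖ ≤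
      ⨆ w : {w : Fin m → ℂ // ∀ k, ‖w k‖ ≤ 1},
        ‖MvPolynomial.eval (fun i : Fin m => esymC m ((i : ℕ) + 1) w.1) q‖) :
    IsGammaUnitary (m + 1) R U := by
  let s : Set (K →L[ℂ] K) := insert U (Set.range R)
  have hadj : ∀ i, adjoint (R i) = R i.rev * adjoint U := fun i => by
    rw [hrev, mul_assoc, hU', mul_one]
  have hext : ∀ Z ∈ s.centralizer, Z ∈ (s ∪ star s).centralizer := by
    intro Z hZ
    have hZU : Commute Z U := (hZ U (Set.mem_insert _ _)).symm
    have hZU' := commute_adjoint_of_commute hU hU' hZU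
    have hZR : ∀ i, Commute Z (R i) := fun i =>
      (hZ (R i) (Set.mem_insert_of_mem _ ⟨i, rfl⟩)).symm
    rintro Y (hY | hY)
    · exact hZ Y hY
    · rw [Set.mem_star] at hY
      have hYs : Y = adjoint (star Y) := (star_star Y).symm
      rcases hY with hY | ⟨i, hY⟩
      · rw [hYs, hY]
        exact hZU'.symm.eq
      · rw [hYs, ← hY, hadj]
        exact ((hZR i.rev).mul_right hZU').symm.eq
  have hs : s ⊆ s.centralizer := by
    rintro X (rfl | ⟨i, rfl⟩) Y (rfl | ⟨j, rfl⟩)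
    · rfl
    · exact (hRU j).eq
    · exact (hRU i).symm.eq
    · exact (hRR j i).eq
  have hs' : s ∪ star s ⊆ s.centralizer := by
    refine Set.union_subset hs fun X hX Y hY => ?_
    exact (hext Y (hs hY) X (Or.inr hX)).symm
  let M : StarSubalgebra ℂ (K →L[ℂ] K) :=
    StarSubalgebra.centralizer ℂ (StarSubalgebra.centralizer ℂ s : Set (K →L[ℂ] K))
  have hM : (M : Set (K →L[ℂ] K)) = (s ∪ star s).centralizer.centralizer :=
    StarSubalgebra.coe_centralizer_centralizer ℂ s
  have hclosed : IsClosed (M : Set (K →L[ℂ] K)) := by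
    rw [hM]
    exact Set.isClosed_centralizer _
  have hcomm : ∀ x y : M, x * y = y * x := by
    intro x y
    have h := Set.centralizer_centralizer_comm_of_comm
      (S := s ∪ star s) fun x hx y hy => (hext x (hs' hx) y hy).symm
    refine Subtype.ext (h x.1 ?_ y.1 ?_)
    · rw [← hM]; exact x.2
    · rw [← hM]; exact y.2
  let _ : CommCStarAlgebra M :=
    { StarSubalgebra.cstarAlgebra M (h_closed := hclosed) with mul_comm := hcomm }
  let π : M →⋆ₐ[ℂ] (K →L[ℂ] K) := M.subtype
  have hπ : Function.Injective π := Subtype.val_injective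
  have hrange : Set.range π = (M : Set (K →L[ℂ] K)) := Subtype.range_coe
  have hbi : Set.centralizer (Set.centralizer (Set.range π)) ⊆ Set.range π := by
    rw [hrange, hM, Set.centralizer_centralizer_centralizer]
  have hsM : ∀ x ∈ s, x ∈ M := fun x hx => by
    have : x ∈ (M : Set (K →L[ℂ] K)) := by
      rw [hM]
      exact Set.subset_centralizer_centralizer (Or.inl hx)
    exact this
  let r : Fin m → M := fun i => ⟨R i, hsM _ (Set.mem_insert_of_mem _ ⟨i, rfl⟩)⟩
  let u : M := ⟨U, hsM _ (Set.mem_insert _ _)⟩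
  have hED := extremallyDisconnected_characterSpace π hπ hbi
  have hchar := exists_unimodular_of_character m r u (Subtype.ext hU)
    (fun i => Subtype.ext (hrev i)) (fun q => by
      refine le_trans (le_of_eq ?_) (hq q)
      rw [← NonUnitalStarAlgHom.norm_map π hπ, coe_aeval_eq_opEval]
      rfl)
  let F : Set (characterSpace ℂ M × (Fin (m + 1) → ℂ)) :=
    {p | (∀ i : Fin m, esymC (m + 1) ((i : ℕ) + 1) p.2 = p.1 (r i)) ∧
      esymC (m + 1) (m + 1) p.2 = p.1 u}
  have hev : ∀ x : M, Continuous fun φ : characterSpace ℂ M => φ x := fun x =>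
    (gelfandStarTransform M x).continuous
  have hF : IsClosed F := by
    have h1 : F = (⋂ i : Fin m, {p | esymC (m + 1) ((i : ℕ) + 1) p.2 = p.1 (r i)}) ∩
        {p | esymC (m + 1) (m + 1) p.2 = p.1 u} := by
      ext p
      simp [F]
    rw [h1]
    exact (isClosed_iInter fun i => isClosed_eq ((continuous_esymC _ _).comp continuous_snd)
      ((hev _).comp continuous_fst)).inter (isClosed_eq
        ((continuous_esymC _ _).comp continuous_snd) ((hev _).comp continuous_fst))
  obtain ⟨f, hf, hf'⟩ := exists_continuous_selection F hF hchar
  let G := gelfandStarTransform M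
  let v : Fin (m + 1) → M := fun k => G.symm ⟨fun φ => f φ k, by fun_prop⟩
  have hv : ∀ k φ, φ (v k) = f φ k := by
    intro k φ
    change G (v k) φ = f φ k
    simp only [v]
    rw [StarAlgEquiv.apply_symm_apply]
    rfl
  have hinj : ∀ x y : M, (∀ φ : characterSpace ℂ M, φ x = φ y) → x = y := fun x y h =>
    G.injective (ContinuousMap.ext h)
  have hvv : ∀ k, star (v k) * v k = 1 := by
    intro k
    refine hinj _ _ fun φ => ?_
    rw [map_mul, map_star, hv, map_one, ← starRingEnd_apply, ← Complex.normSq_eq_conj_mul_self,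
      Complex.normSq_eq_norm_sq, (hf' φ).1 k]
    simp
  have hsym : ∀ i, ∀ φ : characterSpace ℂ M,
      φ (∑ S ∈ Finset.univ.powersetCard i, ∏ k ∈ S, v k) = esymC (m + 1) i (f φ) := by
    intro i φ
    rw [map_sum, esymC]
    refine Finset.sum_congr rfl fun S _ => ?_
    rw [map_prod]
    exact Finset.prod_congr rfl fun k _ => hv k φ
  refine ⟨fun k => π (v k), fun k => ⟨?_, ?_⟩, fun k l => ?_, fun i => ?_, ?_⟩
  · exact congrArg π (hvv k)
  · exact congrArg π ((mul_comm _ _).trans (hvv k))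
  · exact congrArg π (mul_comm (v k) (v l))
  · have h : r i = ∑ S ∈ Finset.univ.powersetCard ((i : ℕ) + 1), ∏ k ∈ S, v k :=
      hinj _ _ fun φ => by rw [hsym, (hf' φ).2.1 i]
    refine (congrArg π h).trans ?_
    rw [map_sum]
    refine Finset.sum_congr rfl fun S _ => ?_
    rw [Finset.prod, ← Finset.sort_eq S (· ≤ ·), Multiset.map_coe, Multiset.prod_coe,
      map_list_prod, List.map_map]
    rfl
  · have h : u = ∏ k, v k := hinj _ _ fun φ => by
      rw [← (hf' φ).2.2, ← hsym]
      congr 1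
      have := Finset.powersetCard_self (Finset.univ : Finset (Fin (m + 1)))
      rw [Finset.card_univ, Fintype.card_fin] at this
      rw [this, Finset.sum_singleton]
    refine (congrArg π h).trans ?_
    rw [← List.prod_ofFn, map_list_prod, List.map_ofFn]
    rfl


/-! ### Extension of the tuple -/

section Extension

variable {U : K →L[ℂ] K} {V : H →L[ℂ] H} {ι : H →ₗᵢ[ℂ] K}

lemma commute_adjoint_left_of_commute {Y : K →L[ℂ] K} (hU : adjoint U * U = 1)
    (hU' : U * adjoint U = 1) (h : Commute Y U) : Commute (adjoint Y) U := by
  have h1 : Commute (star Y) (star (adjoint U)) := (commute_adjoint_of_commute hU hU' h).star_star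
  rwa [star_eq_adjoint, star_eq_adjoint, adjoint_adjoint] at h1

lemma opEval_apply_embedding {n : ℕ} {R : Fin n → K →L[ℂ] K} {S : Fin n → H →L[ℂ] H}
    (h : ∀ i x, R i (ι x) = ι (S i x)) (q : MvPolynomial (Fin n) ℂ) (x : H) :
    opEval q R (ι x) = ι (opEval q S x) := by
  have hprod : ∀ (l : List (Fin n)) (e : Fin n →₀ ℕ) (x : H),
      (l.map fun i => R i ^ e i).prod (ι x) = ι ((l.map fun i => S i ^ e i).prod x) := by
    intro l e
    induction l with
    | nil => intro x; rfl
    | cons i l ih =>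
      intro x
      simp only [List.map_cons, List.prod_cons, mul_apply_eq_comp]
      rw [ih, pow_apply_embedding (h i)]
  simp only [opEval, sum_apply, smul_apply, map_sum, map_smul, List.ofFn_eq_map, hprod]

lemma commute_opEval {n : ℕ} {R : Fin n → K →L[ℂ] K} (h : ∀ i, Commute (R i) U)
    (q : MvPolynomial (Fin n) ℂ) : Commute (opEval q R) U := by
  refine Commute.sum_left _ _ _ fun e _ => Commute.smul_left ?_ _
  refine Commute.list_prod_left _ _ fun T hT => ?_
  obtain ⟨i, rfl⟩ := (List.mem_ofFn' _ _).1 hT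
  exact (h i).pow_left _

lemma eq_adjoint_mul_of_extends {R R' : K →L[ℂ] K} {S S' : H →L[ℂ] H}
    (hU : adjoint U * U = 1) (hU' : U * adjoint U = 1) (hι : ∀ x, U (ι x) = ι (V x))
    (hmin : ∀ y, (∀ (n : ℕ) (h : H), inner ℂ (ι h) ((U ^ n) y) = 0) → y = 0)
    (hR : Commute R U) (hR' : Commute R' U) (hS' : Commute S' V)
    (hRS : ∀ x, R (ι x) = ι (S x)) (hRS' : ∀ x, R' (ι x) = ι (S' x))
    (h : S' = adjoint S * V) : R' = adjoint R * U := by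
  have hRa := commute_adjoint_left_of_commute hU hU' hR
  refine eq_of_commute_of_eq_on hU hU' (dense_range_pow_adjoint hU hι hmin) hR'
    (hRa.mul_left (Commute.refl U)) fun x => ?_
  refine sub_eq_zero.1 (hmin _ fun n k => ?_)
  have h1 : (U ^ n) ((adjoint R * U) (ι x)) = adjoint R (ι ((V * V ^ n) x)) := by
    rw [← pow_succ', ← pow_apply_embedding hι, ← mul_apply_eq_comp, ← mul_apply_eq_comp,
      ← mul_assoc, ← (hRa.pow_right n).eq, mul_assoc, ← pow_succ]
  have h2 : (U ^ n) (R' (ι x)) = ι (S' ((V ^ n) x)) := by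
    rw [hRS', pow_apply_embedding hι, ← mul_apply_eq_comp, ← (hS'.pow_right n).eq]
    rfl
  rw [map_sub, inner_sub_right, h1, h2, adjoint_inner_right, hRS, ι.inner_map_map,
    ι.inner_map_map, h, mul_apply_eq_comp, mul_apply_eq_comp, adjoint_inner_right, sub_self]

lemma span_zpowU_topologicalClosure_eq_top
    (hD : Dense {y : K | ∃ (n : ℕ) (h : H), y = (adjoint U ^ n) (ι h)}) :
    (Submodule.span ℂ {y : K | ∃ (m : ℤ) (h : H), y = zpowU U m (ι h)}).topologicalClosure
      = ⊤ := by
  rw [← Submodule.dense_iff_topologicalClosure_eq_top]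
  refine hD.mono ?_
  rintro _ ⟨n, h, rfl⟩
  refine Submodule.subset_span ⟨-(n : ℤ), h, ?_⟩
  obtain rfl | hn := Nat.eq_zero_or_pos n
  · simp [zpowU]
  · rw [zpowU, if_neg (by omega), neg_neg, Int.toNat_natCast]

end Extension

/-- **Theorem 5.5(1)**: every `Γ_d`-isometry `(S_1, …, S_{d-1}, V)` on `H` has a
minimal `Γ_d`-unitary extension `(R_1, …, R_{d-1}, U)` on a Hilbert space `K ⊇ H`
(minimal in the sense that `K` is the closed span of `{U^m h : h ∈ H, m ∈ ℤ}`);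
moreover the extension can be chosen so that a bounded operator `X` on `H` commutes
with each of `S_1, …, S_{d-1}, V` if and only if `X` has a unique norm-preserving
extension `Y` on `K` commuting with each of `R_1, …, R_{d-1}, U`. -/
theorem stmt4 (d : ℕ) (hd : 2 ≤ d) {H : Type u} [NormedAddCommGroup H]
    [InnerProductSpace ℂ H] [CompleteSpace H]
    (S : Fin (d - 1) → H →L[ℂ] H) (V : H →L[ℂ] H) (hSV : IsGammaIsometry d S V) :
    ∃ (K : Type u) (_ : NormedAddCommGroup K) (_ : InnerProductSpace ℂ K)
      (_ : CompleteSpace K) (ι : H →ₗᵢ[ℂ] K)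
      (R : Fin (d - 1) → K →L[ℂ] K) (U : K →L[ℂ] K),
      IsGammaUnitary d R U ∧
      (∀ i x, R i (ι x) = ι (S i x)) ∧
      (∀ x, U (ι x) = ι (V x)) ∧
      (Submodule.span ℂ
          {y : K | ∃ (m : ℤ) (h : H), y = zpowU U m (ι h)}).topologicalClosure = ⊤ ∧
      (∀ X : H →L[ℂ] H,
        ((∀ i, Commute X (S i)) ∧ Commute X V) ↔
          ∃! Y : K →L[ℂ] K,
            (∀ x, Y (ι x) = ι (X x)) ∧ ‖Y‖ = ‖X‖ ∧
            (∀ i, Commute Y (R i)) ∧ Commute Y U) := by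
  obtain ⟨m, rfl⟩ : ∃ m, d = m + 1 := ⟨d - 1, by omega⟩
  obtain ⟨hSS, hSV', hV, hSrev, -, hcontr⟩ := hSV
  obtain ⟨K, _, _, _, ι, U, hU, hU', hι, hmin, hlift⟩ := exists_minimal_unitary_extension V hV
  have hD := dense_range_pow_adjoint hU hι hmin
  choose R hRU hRS using fun i => hlift (S i) (hSV' i)
  have hcomm : ∀ {Y Z : K →L[ℂ] K} {X T : H →L[ℂ] H}, Commute Y U → Commute Z U →
      (∀ x, Y (ι x) = ι (X x)) → (∀ x, Z (ι x) = ι (T x)) → Commute X T → Commute Y Z := by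
    intro Y Z X T hY hZ hYX hZT h
    refine eq_of_commute_of_eq_on hU hU' hD (hY.mul_left hZ) (hZ.mul_left hY) fun x => ?_
    rw [mul_apply_eq_comp, mul_apply_eq_comp, hYX, hZT, hYX, hZT, ← mul_apply_eq_comp, h.eq,
      mul_apply_eq_comp]
  refine ⟨K, _, _, _, ι, R, U, ?_, hRS, hι, span_zpowU_topologicalClosure_eq_top hD, ?_⟩
  · refine isGammaUnitary_of_relations m R U
      (fun i j => hcomm (hRU i) (hRU j) (hRS i) (hRS j) (hSS i j)) hRU hU hU'
      (fun i => eq_adjoint_mul_of_extends hU hU' hι hmin (hRU i) (hRU _) (hSV' _) (hRS i)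
        (hRS _) (hSrev i)) fun q => ?_
    refine le_trans (le_of_eq ?_) (hcontr q)
    refine norm_eq_of_commute_of_extends hU hU' hD
      (commute_opEval (fun i => (hRU i).smul_left _) q)
      (opEval_apply_embedding (fun i x => ?_) q)
    rw [smul_apply, smul_apply, hRS, map_smul]
  · intro X
    constructor
    · rintro ⟨hXS, hXV⟩
      obtain ⟨Y, hYU, hYX⟩ := hlift X hXV
      refine ⟨Y, ⟨hYX, norm_eq_of_commute_of_extends hU hU' hD hYU hYX,
        fun i => hcomm hYU (hRU i) hYX (hRS i) (hXS i), hYU⟩, ?_⟩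
      rintro Z ⟨hZX, -, -, hZU⟩
      exact eq_of_commute_of_eq_on hU hU' hD hZU hYU fun x => by rw [hZX, hYX]
    · rintro ⟨Y, ⟨hYX, -, hYR, hYU⟩, -⟩
      have hcomp : ∀ {Z : K →L[ℂ] K} {T : H →L[ℂ] H}, (∀ x, Z (ι x) = ι (T x)) →
          Commute Y Z → Commute X T := by
        intro Z T hZT h
        refine ContinuousLinearMap.ext fun x => ι.injective ?_
        have := congrArg (fun A : K →L[ℂ] K => A (ι x)) h.eq
        simpa only [mul_apply_eq_comp, hYX, hZT] using this
      exact ⟨fun i => hcomp (hRS i) (hYR i), hcomp hι hYU⟩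

end GammaOps
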